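/- Suppose S is not identically zero on any subrectangle of D (so M̄_n is primitive for all n). Then the upper box dimension of the graph of the generalized affine FIF f satisfies dim_B̄ Γf ≤ max{2, 1 + log ρ*/log N}, where ρ* = lim_{n→∞} ρ(M̄_n). -/

import Mathlib

open scoped BigOperators

noncomputable def oscil (φ : ℝ × ℝ → ℝ) (E : Set (ℝ × ℝ)) : ℝ :=
  sSup ((fun p : (ℝ × ℝ) × (ℝ × ℝ) => φ p.1 - φ p.2) '' (E ×ˢ E))

noncomputable def eudist (s t : ℝ × ℝ) : ℝ :=
  Real.sqrt ((s.1 - t.1) ^ 2 + (s.2 - t.2) ^ 2)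

noncomputable def uMap (x0 len : ℝ) (N : ℕ) (i : Fin N) (x : ℝ) : ℝ :=
  if i.val % 2 = 0 then x0 + i.val * (len / N) + (x - x0) / N
  else x0 + (i.val + 1) * (len / N) - (x - x0) / N

noncomputable def uInv (x0 len : ℝ) (N : ℕ) (i : Fin N) (y : ℝ) : ℝ :=
  if i.val % 2 = 0 then x0 + N * (y - (x0 + i.val * (len / N)))
  else x0 + N * ((x0 + (i.val + 1) * (len / N)) - y)

noncomputable def Lmap (x0 y0 len : ℝ) (N : ℕ) (w : Fin N × Fin N) (t : ℝ × ℝ) : ℝ × ℝ :=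
  (uMap x0 len N w.1 t.1, uMap y0 len N w.2 t.2)

noncomputable def LInv (x0 y0 len : ℝ) (N : ℕ) (w : Fin N × Fin N) (t : ℝ × ℝ) : ℝ × ℝ :=
  (uInv x0 len N w.1 t.1, uInv y0 len N w.2 t.2)

noncomputable def sqD (x0 y0 len : ℝ) : Set (ℝ × ℝ) :=
  Set.Icc x0 (x0 + len) ×ˢ Set.Icc y0 (y0 + len)

noncomputable def cell (x0 y0 len : ℝ) (N : ℕ) : List (Fin N × Fin N) → Set (ℝ × ℝ)
  | [] => sqD x0 y0 len
  | w :: ws => Lmap x0 y0 len N w '' cell x0 y0 len N ws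

noncomputable def oscSum (x0 y0 len : ℝ) (N : ℕ) (φ : ℝ × ℝ → ℝ)
    (p : List (Fin N × Fin N)) (k : ℕ) : ℝ :=
  ∑ w : Fin k → Fin N × Fin N, oscil φ (cell x0 y0 len N (p ++ List.ofFn w))

noncomputable def supAbs (S : ℝ × ℝ → ℝ) (E : Set (ℝ × ℝ)) : ℝ :=
  sSup ((fun t => |S t|) '' E)

noncomputable def infAbs (S : ℝ × ℝ → ℝ) (E : Set (ℝ × ℝ)) : ℝ :=
  sInf ((fun t => |S t|) '' E)

open Classical in
noncomputable def upMat (x0 y0 len : ℝ) (N : ℕ) (S : ℝ × ℝ → ℝ) (m : ℕ) :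
    Matrix (Fin (m + 1) → Fin N × Fin N) (Fin (m + 1) → Fin N × Fin N) ℝ :=
  fun i j =>
    if ∀ k : Fin m, i k.succ = j k.castSucc then
      supAbs S (cell x0 y0 len N (List.ofFn i ++ [j (Fin.last m)]))
    else 0

open Classical in
noncomputable def lowMat (x0 y0 len : ℝ) (N : ℕ) (S : ℝ × ℝ → ℝ) (m : ℕ) :
    Matrix (Fin (m + 1) → Fin N × Fin N) (Fin (m + 1) → Fin N × Fin N) ℝ :=
  fun i j =>
    if ∀ k : Fin m, i k.succ = j k.castSucc then
      infAbs S (cell x0 y0 len N (List.ofFn i ++ [j (Fin.last m)]))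
    else 0

noncomputable def specRad {α : Type*} [Fintype α] [DecidableEq α] (A : Matrix α α ℝ) : ENNReal :=
  spectralRadius ℂ (A.map (fun x : ℝ => (x : ℂ)))

noncomputable def cubeCount (E : Set (ℝ × ℝ × ℝ)) (ε : ℝ) : ℕ :=
  Nat.card {n : ℤ × ℤ × ℤ |
    (((Set.Icc ((n.1 : ℝ) * ε) (((n.1 : ℝ) + 1) * ε)) ×ˢ
      ((Set.Icc ((n.2.1 : ℝ) * ε) (((n.2.1 : ℝ) + 1) * ε)) ×ˢ
        (Set.Icc ((n.2.2 : ℝ) * ε) (((n.2.2 : ℝ) + 1) * ε)))) ∩ E).Nonempty}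

noncomputable def ubDim (E : Set (ℝ × ℝ × ℝ)) : ℝ :=
  Filter.limsup (fun ε : ℝ => Real.log (cubeCount E ε) / Real.log (1 / ε))
    (nhdsWithin 0 (Set.Ioi 0))

noncomputable def lbDim (E : Set (ℝ × ℝ × ℝ)) : ℝ :=
  Filter.liminf (fun ε : ℝ => Real.log (cubeCount E ε) / Real.log (1 / ε))
    (nhdsWithin 0 (Set.Ioi 0))

def graphOn (f : ℝ × ℝ → ℝ) (D : Set (ℝ × ℝ)) : Set (ℝ × ℝ × ℝ) :=
  {p | (p.1, p.2.1) ∈ D ∧ p.2.2 = f (p.1, p.2.1)}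

section MatrixGrowth

variable {α : Type*} [Fintype α] [DecidableEq α]

attribute [local instance] Matrix.linftyOpNormedRing Matrix.linftyOpNormedAlgebra

lemma sum_row_le_linftyOpNorm (A : Matrix α α ℂ) (i : α) : ∑ j, ‖A i j‖ ≤ ‖A‖ := by
  have h : ∑ j, ‖A i j‖₊ ≤ ‖A‖₊ := by
    rw [Matrix.linfty_opNNNorm_def]
    exact Finset.le_sup (f := fun i => ∑ j, ‖A i j‖₊) (Finset.mem_univ i)
  simpa using NNReal.coe_le_coe.2 h

lemma exists_pow_row_sum_le (A : Matrix α α ℝ) {r : ℝ} (hr : 0 < r)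
    (h : specRad A < ENNReal.ofReal r) :
    ∃ n : ℕ, 1 ≤ n ∧ ∀ i, ∑ j, (A ^ n) i j ≤ r ^ n := by
  have hlim := spectrum.pow_nnnorm_pow_one_div_tendsto_nhds_spectralRadius
    (A.map (fun x : ℝ => (x : ℂ)))
  obtain ⟨n, hn, hn1⟩ :=
    ((hlim.eventually (gt_mem_nhds h)).and (Filter.eventually_ge_atTop 1)).exists
  refine ⟨n, hn1, fun i => ?_⟩
  have hmap : (A.map (fun x : ℝ => (x : ℂ))) ^ n = (A ^ n).map (fun x : ℝ => (x : ℂ)) :=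
    (Matrix.map_pow A Complex.ofRealHom n).symm
  rw [hmap] at hn
  have hn0 : (0 : ℝ) < n := by exact_mod_cast hn1
  have hnorm : ‖(A ^ n).map (fun x : ℝ => (x : ℂ))‖ ≤ r ^ n := by
    have h1 := ENNReal.rpow_le_rpow hn.le hn0.le
    rw [← ENNReal.rpow_mul, one_div, inv_mul_cancel₀ hn0.ne', ENNReal.rpow_one,
      ENNReal.rpow_natCast, ← ENNReal.ofReal_pow hr.le, ENNReal.ofReal, ENNReal.coe_le_coe,
      Real.le_toNNReal_iff_coe_le (by positivity)] at h1
    exact h1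
  calc ∑ j, (A ^ n) i j ≤ ∑ j, ‖((A ^ n).map (fun x : ℝ => (x : ℂ))) i j‖ := by
        refine Finset.sum_le_sum fun j _ => ?_
        simpa using le_abs_self _
    _ ≤ _ := (sum_row_le_linftyOpNorm _ i).trans hnorm

lemma specRad_le_of_row_sum_le (A : Matrix α α ℝ) (hA : ∀ i j, 0 ≤ A i j) {b : ℝ} (hb : 0 ≤ b)
    (h : ∀ i, ∑ j, A i j ≤ b) : specRad A ≤ ENNReal.ofReal b := by
  rcases isEmpty_or_nonempty α with hα | hα
  · simp [specRad, spectralRadius, spectrum.of_subsingleton]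
  refine (spectrum.spectralRadius_le_nnnorm _).trans ?_
  rw [ENNReal.ofReal, ENNReal.coe_le_coe, Matrix.linfty_opNNNorm_def]
  refine Finset.sup_le fun i _ => ?_
  rw [← NNReal.coe_le_coe, Real.coe_toNNReal b hb]
  simpa [abs_of_nonneg (hA i _)] using h i

/-- A nonnegative matrix has, for every `r` above its spectral radius, a strictly positive
subinvariant vector. -/
lemma exists_subinvariant_vector (A : Matrix α α ℝ) (hA : ∀ i j, 0 ≤ A i j) {r : ℝ} (hr : 0 < r)
    (h : specRad A < ENNReal.ofReal r) :
    ∃ u : α → ℝ, (∀ i, 1 ≤ u i) ∧ ∀ i, A.mulVec u i ≤ r * u i := by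
  obtain ⟨n, hn, hrow⟩ := exists_pow_row_sum_le A hr h
  have hpow : ∀ k i, 0 ≤ (A ^ k).mulVec 1 i := by
    intro k
    induction k with
    | zero => intro i; simp
    | succ k ih =>
      intro i
      rw [pow_succ', ← Matrix.mulVec_mulVec]
      exact Finset.sum_nonneg fun j _ => mul_nonneg (hA i j) (ih j)
  let e : ℕ → α → ℝ := fun k => (r⁻¹) ^ k • (A ^ k).mulVec 1
  have he : ∀ k i, 0 ≤ e k i := fun k i => mul_nonneg (by positivity) (hpow k i)
  have hstep : ∀ k, A.mulVec (e k) = r • e (k + 1) := by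
    intro k
    simp only [e, Matrix.mulVec_smul, Matrix.mulVec_mulVec, ← pow_succ', smul_smul]
    rw [pow_succ' r⁻¹, ← mul_assoc, mul_inv_cancel₀ hr.ne', one_mul]
  have he0 : ∀ i, e 0 i = 1 := by intro i; simp [e]
  have hen : ∀ i, e n i ≤ 1 := by
    intro i
    have h1 : (A ^ n).mulVec 1 i ≤ r ^ n := by simpa [Matrix.mulVec, dotProduct] using hrow i
    calc e n i = (r⁻¹) ^ n * (A ^ n).mulVec 1 i := rfl
      _ ≤ (r⁻¹) ^ n * r ^ n := by gcongr
      _ = 1 := by rw [← mul_pow, inv_mul_cancel₀ hr.ne', one_pow]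
  refine ⟨fun i => ∑ k ∈ Finset.range n, e k i, fun i => ?_, fun i => ?_⟩
  · rw [← he0 i]
    exact Finset.single_le_sum (f := fun k => e k i) (fun k _ => he k i)
      (Finset.mem_range.2 hn)
  · have h1 : A.mulVec (fun i => ∑ k ∈ Finset.range n, e k i) i
        = ∑ k ∈ Finset.range n, r * e (k + 1) i := by
      have : (fun i => ∑ k ∈ Finset.range n, e k i) = ∑ k ∈ Finset.range n, e k := by
        ext i; simp
      rw [this, Matrix.mulVec_sum, Finset.sum_apply]
      exact Finset.sum_congr rfl fun k _ => by rw [hstep]; rfl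
    rw [h1, ← Finset.mul_sum]
    refine mul_le_mul_of_nonneg_left ?_ hr.le
    have h2 := Finset.sum_range_succ (fun k => e k i) n
    rw [Finset.sum_range_succ'] at h2
    linarith [he0 i, hen i]

lemma exists_growth_bound (A : Matrix α α ℝ) (hA : ∀ i j, 0 ≤ A i j) {r b C : ℝ} (hb : 0 ≤ b)
    (hbr : b < r) (hC : 0 ≤ C) (h : specRad A < ENNReal.ofReal r) (v : ℕ → α → ℝ)
    (hv : ∀ k i, v (k + 1) i ≤ A.mulVec (v k) i + C * b ^ (k + 1)) :
    ∃ K : ℝ, 0 ≤ K ∧ ∀ k i, v k i ≤ K * r ^ k := by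
  have hr : 0 < r := hb.trans_lt hbr
  obtain ⟨u, hu1, hu⟩ := exists_subinvariant_vector A hA hr h
  set B := C * b / (r - b) with hB
  have hB0 : 0 ≤ B := div_nonneg (mul_nonneg hC hb) (sub_pos.2 hbr).le
  have hBr : B * (r - b) = C * b := div_mul_cancel₀ _ (sub_pos.2 hbr).ne'
  set V := ∑ i, |v 0 i|
  have hV : ∀ i, v 0 i ≤ V := fun i => (le_abs_self _).trans
    (Finset.single_le_sum (f := fun i => |v 0 i|) (fun _ _ => abs_nonneg _) (Finset.mem_univ i))
  have hV0 : 0 ≤ V := Finset.sum_nonneg fun _ _ => abs_nonneg _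
  have key : ∀ k i, v k i ≤ ((V + B) * r ^ k - B * b ^ k) * u i := by
    intro k
    induction k with
    | zero =>
      intro i
      have := hV i
      simp only [pow_zero, mul_one, add_sub_cancel_right]
      nlinarith [hu1 i]
    | succ k ih =>
      intro i
      have hcoef : 0 ≤ (V + B) * r ^ k - B * b ^ k := by
        have : b ^ k ≤ r ^ k := by gcongr
        have h3 : 0 ≤ r ^ k := by positivity
        nlinarith
      have h1 : A.mulVec (v k) i ≤ ((V + B) * r ^ k - B * b ^ k) * A.mulVec u i := by
        simp only [Matrix.mulVec, dotProduct, Finset.mul_sum]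
        refine Finset.sum_le_sum fun j _ => ?_
        calc A i j * v k j ≤ A i j * (((V + B) * r ^ k - B * b ^ k) * u j) :=
              mul_le_mul_of_nonneg_left (ih j) (hA i j)
          _ = _ := by ring
      have h2 : C * b ^ (k + 1) ≤ C * b ^ (k + 1) * u i :=
        le_mul_of_one_le_right (by positivity) (hu1 i)
      calc v (k + 1) i ≤ ((V + B) * r ^ k - B * b ^ k) * (r * u i) + C * b ^ (k + 1) * u i := by
            refine (hv k i).trans (add_le_add (h1.trans ?_) h2)
            exact mul_le_mul_of_nonneg_left (hu i) hcoef
        _ = ((V + B) * r ^ (k + 1) - B * b ^ (k + 1)) * u i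
              - (B * (r - b) - C * b) * b ^ k * u i := by ring
        _ = _ := by rw [hBr]; ring
  refine ⟨(V + B) * ∑ i, u i, mul_nonneg (by positivity)
    (Finset.sum_nonneg fun i _ => zero_le_one.trans (hu1 i)), fun k i => ?_⟩
  have hui : u i ≤ ∑ i, u i := Finset.single_le_sum (f := u)
    (fun i _ => zero_le_one.trans (hu1 i)) (Finset.mem_univ i)
  have hu0 : 0 ≤ u i := zero_le_one.trans (hu1 i)
  calc v k i ≤ ((V + B) * r ^ k - B * b ^ k) * u i := key k i
    _ ≤ ((V + B) * r ^ k) * u i := by gcongr; linarith [mul_nonneg hB0 (pow_nonneg hb k)]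
    _ ≤ ((V + B) * r ^ k) * ∑ i, u i := by gcongr
    _ = _ := by ring

end MatrixGrowth

section BoxCounting

lemma card_Icc_ceil_floor_le {a b : ℝ} (hab : a ≤ b) :
    ((Finset.Icc ⌈a⌉ ⌊b⌋).card : ℝ) ≤ b - a + 1 := by
  rw [Int.card_Icc]
  have h : (((⌊b⌋ + 1 - ⌈a⌉).toNat : ℤ) : ℝ) = max ((⌊b⌋ : ℝ) + 1 - ⌈a⌉) 0 := by
    rw [Int.toNat_eq_max]; push_cast; rfl
  rw [← Int.cast_natCast, h]
  exact max_le (by linarith [Int.floor_le b, Int.le_ceil a]) (by linarith)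

lemma mem_Icc_ceil_floor {ε x y δ : ℝ} (hε : 0 < ε) {n : ℤ}
    (hx : x ∈ Set.Icc ((n : ℝ) * ε) (((n : ℝ) + 1) * ε)) (hxy : |x - y| ≤ δ) :
    n ∈ Finset.Icc ⌈y / ε - δ / ε - 1⌉ ⌊y / ε + δ / ε⌋ := by
  obtain ⟨h1, h2⟩ := abs_le.1 hxy
  rw [Finset.mem_Icc, Int.ceil_le, Int.le_floor, ← sub_div, ← add_div, le_div_iff₀ hε,
    sub_le_iff_le_add, div_le_iff₀ hε]
  exact ⟨by linarith [hx.2], by linarith [hx.1]⟩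

lemma cubeCount_graphOn_le {ι : Type*} [Fintype ι] (f : ℝ × ℝ → ℝ) (D : Set (ℝ × ℝ))
    (c : ι → Set (ℝ × ℝ)) (o : ι → ℝ) {ε : ℝ} (hε : 0 < ε) (ho : ∀ i, 0 ≤ o i)
    (hcov : ∀ t ∈ D, ∃ i, t ∈ c i)
    (hc : ∀ i, ∀ t ∈ c i, ∀ t' ∈ c i,
      |t.1 - t'.1| ≤ ε ∧ |t.2 - t'.2| ≤ ε ∧ |f t - f t'| ≤ o i) :
    (cubeCount (graphOn f D) ε : ℝ) ≤ ∑ i, 16 * (2 * (o i / ε) + 2) := by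
  classical
  have hp : ∀ i, ∃ p : ℝ × ℝ, ∀ t ∈ c i,
      |t.1 - p.1| ≤ ε ∧ |t.2 - p.2| ≤ ε ∧ |f t - f p| ≤ o i := by
    intro i
    rcases (c i).eq_empty_or_nonempty with h | ⟨p, hp⟩
    · exact ⟨0, by simp [h]⟩
    · exact ⟨p, fun t ht => hc i t ht p hp⟩
  choose p hp using hp
  let I : ℝ → ℝ → Finset ℤ := fun y δ => Finset.Icc ⌈y / ε - δ / ε - 1⌉ ⌊y / ε + δ / ε⌋
  have hI : ∀ y δ, 0 ≤ δ → ((I y δ).card : ℝ) ≤ 2 * (δ / ε) + 2 := by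
    intro y δ hδ
    have h0 : 0 ≤ δ / ε := by positivity
    refine (card_Icc_ceil_floor_le (by linarith)).trans (le_of_eq (by ring))
  let F : ι → Finset (ℤ × ℤ × ℤ) := fun i => I (p i).1 ε ×ˢ (I (p i).2 ε ×ˢ I (f (p i)) (o i))
  have hF : ∀ i, ((F i).card : ℝ) ≤ 16 * (2 * (o i / ε) + 2) := by
    intro i
    have h1 := hI (p i).1 ε hε.le
    have h2 := hI (p i).2 ε hε.le
    have h3 := hI (f (p i)) (o i) (ho i)
    rw [div_self hε.ne'] at h1 h2
    simp only [F, Finset.card_product, Nat.cast_mul]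
    calc _ ≤ (2 * 1 + 2 : ℝ) * ((2 * 1 + 2) * (2 * (o i / ε) + 2)) := by gcongr
      _ = _ := by ring
  have hsub : {n : ℤ × ℤ × ℤ |
      (((Set.Icc ((n.1 : ℝ) * ε) (((n.1 : ℝ) + 1) * ε)) ×ˢ
        ((Set.Icc ((n.2.1 : ℝ) * ε) (((n.2.1 : ℝ) + 1) * ε)) ×ˢ
          (Set.Icc ((n.2.2 : ℝ) * ε) (((n.2.2 : ℝ) + 1) * ε)))) ∩ graphOn f D).Nonempty}
      ⊆ (Finset.univ.biUnion F : Finset (ℤ × ℤ × ℤ)) := by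
    rintro ⟨a, b, d⟩ ⟨⟨x, y, z⟩, ⟨hx, hy, hz⟩, hD, hfz⟩
    obtain ⟨i, hi⟩ := hcov _ hD
    obtain ⟨h1, h2, h3⟩ := hp i _ hi
    simp only at hfz hx hy hz h1 h2
    rw [← hfz] at h3
    simp only [Finset.coe_biUnion, Set.mem_iUnion, Finset.mem_coe]
    refine ⟨i, Finset.mem_univ _, Finset.mem_product.2 ⟨mem_Icc_ceil_floor hε hx h1,
      Finset.mem_product.2 ⟨mem_Icc_ceil_floor hε hy h2, mem_Icc_ceil_floor hε hz h3⟩⟩⟩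
  have hcard : cubeCount (graphOn f D) ε ≤ ∑ i, (F i).card := by
    refine (Nat.card_mono (Finset.finite_toSet _) hsub).trans ?_
    rw [Nat.card_coe_set_eq, Set.ncard_coe_finset]
    exact Finset.card_biUnion_le
  calc (cubeCount (graphOn f D) ε : ℝ) ≤ ((∑ i, (F i).card : ℕ) : ℝ) := by exact_mod_cast hcard
    _ ≤ _ := by rw [Nat.cast_sum]; exact Finset.sum_le_sum fun i _ => hF i

lemma ubDim_le_of_log_cubeCount_le (E : Set (ℝ × ℝ × ℝ)) {K T : ℝ}
    (h : ∀ᶠ ε in nhdsWithin (0 : ℝ) (Set.Ioi 0),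
      Real.log (cubeCount E ε) ≤ K + T * Real.log (1 / ε)) : ubDim E ≤ T := by
  have hL : Filter.Tendsto (fun ε : ℝ => Real.log (1 / ε)) (nhdsWithin 0 (Set.Ioi 0))
      Filter.atTop := by
    simp only [one_div]
    exact Real.tendsto_log_atTop.comp tendsto_inv_nhdsGT_zero
  have hlim : Filter.Tendsto (fun ε : ℝ => K / Real.log (1 / ε) + T) (nhdsWithin 0 (Set.Ioi 0))
      (nhds T) := by
    simpa using (hL.const_div_atTop K).add_const T
  have hpos := hL.eventually_gt_atTop 0
  rw [← hlim.limsup_eq]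
  refine Filter.limsup_le_limsup ?_ ?_ hlim.isBoundedUnder_le
  · filter_upwards [h, hpos] with ε h1 h2
    rw [div_le_iff₀ h2, add_mul, div_mul_cancel₀ _ h2.ne']
    exact h1
  · refine Filter.IsBoundedUnder.isCoboundedUnder_le ⟨0, ?_⟩
    rw [Filter.eventually_map]
    filter_upwards [hpos] with ε h2
    exact div_nonneg (Real.log_natCast_nonneg _) h2.le

/-- A bound `O((r b) ^ k)` on the number of cubes at every scale comparable to `b ^ (-k)` bounds
the upper box dimension. -/
lemma ubDim_le_of_cubeCount_le (E : Set (ℝ × ℝ × ℝ)) {s b r K : ℝ} (hs : 0 < s) (hb : 1 < b)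
    (hr : 1 ≤ r) (hK : 0 ≤ K)
    (h : ∀ (k : ℕ) (ε : ℝ), 0 < ε → s / b ^ k ≤ ε → 1 / ε ≤ b ^ k / s →
      (cubeCount E ε : ℝ) ≤ K * (r * b) ^ k) :
    ubDim E ≤ 1 + Real.log r / Real.log b := by
  have hb0 : 0 < b := by linarith
  have hlb : 0 < Real.log b := Real.log_pos hb
  have hT : 0 ≤ 1 + Real.log r / Real.log b := by
    have := Real.log_nonneg hr
    positivity
  refine ubDim_le_of_log_cubeCount_le E
    (K := Real.log (K + 1) + (1 + Real.log r / Real.log b) * Real.log (b * s)) ?_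
  filter_upwards [Ioo_mem_nhdsGT hs] with ε hε
  obtain ⟨hε0, hεs⟩ := hε
  obtain ⟨n, hn1, hn2⟩ := exists_nat_pow_near ((one_le_div hε0).2 hεs.le) hb
  have hbn : 0 < b ^ (n + 1) := by positivity
  have hc := h (n + 1) ε hε0
    (by rw [div_le_iff₀ hbn, mul_comm, ← div_le_iff₀ hε0]; exact hn2.le)
    (by rw [le_div_iff₀ hs, one_div_mul_eq_div]; exact hn2.le)
  have hrb : 1 ≤ (r * b) ^ (n + 1) := one_le_pow₀ (by nlinarith)
  have hlog : Real.log (cubeCount E ε) ≤ Real.log ((K + 1) * (r * b) ^ (n + 1)) := by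
    rcases Nat.eq_zero_or_pos (cubeCount E ε) with h0 | h0
    · rw [h0, Nat.cast_zero, Real.log_zero]
      exact Real.log_nonneg (by nlinarith)
    · exact Real.log_le_log (by exact_mod_cast h0) (hc.trans (by nlinarith))
  have hn3 : ((n + 1 : ℕ) : ℝ) * Real.log b ≤ Real.log (b * s) + Real.log (1 / ε) := by
    rw [← Real.log_pow, ← Real.log_mul (by positivity) (by positivity)]
    refine Real.log_le_log hbn ?_
    calc b ^ (n + 1) = b * b ^ n := pow_succ' b n
      _ ≤ b * (s / ε) := by gcongr
      _ = _ := by ring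
  rw [Real.log_mul (by positivity) (by positivity), Real.log_pow,
    Real.log_mul (by positivity) (by positivity)] at hlog
  calc _ ≤ _ := hlog
    _ = Real.log (K + 1) + (1 + Real.log r / Real.log b) * (((n + 1 : ℕ) : ℝ) * Real.log b) := by
      field_simp
      ring
    _ ≤ Real.log (K + 1) + (1 + Real.log r / Real.log b) *
        (Real.log (b * s) + Real.log (1 / ε)) := by gcongr
    _ = _ := by ring

end BoxCounting

section Cells

variable {x0 y0 len : ℝ} {N : ℕ}

lemma uMap_mem_Icc (hlen : 0 < len) (i : Fin N) {x : ℝ} (hx : x ∈ Set.Icc x0 (x0 + len)) :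
    uMap x0 len N i x ∈ Set.Icc x0 (x0 + len) := by
  have hN : (0 : ℝ) < N := by exact_mod_cast i.pos
  have hi : ((i.val : ℝ) + 1) ≤ N := by exact_mod_cast i.isLt
  have hd : 0 < len / N := by positivity
  have hNd : N * (len / N) = len := mul_div_cancel₀ _ hN.ne'
  have h1 : 0 ≤ (x - x0) / N := div_nonneg (by linarith [hx.1]) hN.le
  have h2 : (x - x0) / N ≤ len / N := by gcongr; linarith [hx.2]
  have h3 : (0 : ℝ) ≤ i.val * (len / N) := by positivity
  have h4 : ((i.val : ℝ) + 1) * (len / N) ≤ N * (len / N) := by gcongr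
  rw [hNd] at h4
  unfold uMap
  split_ifs <;> constructor <;> linarith

lemma abs_uMap_sub (i : Fin N) (x y : ℝ) :
    |uMap x0 len N i x - uMap x0 len N i y| = |x - y| / N := by
  have h : |(x - y) / (N : ℝ)| = |x - y| / N := by rw [abs_div, Nat.abs_cast]
  rw [← h]
  unfold uMap
  split_ifs
  · congr 1; ring
  · rw [← abs_neg]; congr 1; ring

lemma uInv_uMap (i : Fin N) (x : ℝ) : uInv x0 len N i (uMap x0 len N i x) = x := by
  have hN : (N : ℝ) ≠ 0 := by exact_mod_cast i.pos.ne'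
  unfold uInv uMap
  split_ifs <;> field_simp <;> ring

lemma exists_uMap_eq (hlen : 0 < len) (hN : 0 < N) {x : ℝ} (hx : x ∈ Set.Icc x0 (x0 + len)) :
    ∃ i : Fin N, ∃ y ∈ Set.Icc x0 (x0 + len), uMap x0 len N i y = x := by
  have hN' : (0 : ℝ) < N := by exact_mod_cast hN
  have hx0 : 0 ≤ x - x0 := by linarith [hx.1]
  obtain ⟨i, hi1, hi2⟩ : ∃ i : Fin N, (i.val : ℝ) ≤ N * (x - x0) / len ∧
      N * (x - x0) / len ≤ i.val + 1 := by
    have hz0 : 0 ≤ N * (x - x0) / len := by positivity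
    rcases lt_or_ge ⌊N * (x - x0) / len⌋₊ N with h | h
    · exact ⟨⟨_, h⟩, Nat.floor_le hz0, (Nat.lt_floor_add_one _).le⟩
    · have hle : N * (x - x0) / len ≤ N := by
        rw [div_le_iff₀ hlen]
        gcongr
        linarith [hx.2]
      have hge : (N : ℝ) ≤ N * (x - x0) / len := (Nat.le_floor_iff hz0).1 h
      refine ⟨⟨N - 1, by omega⟩, ?_, ?_⟩ <;> push_cast [Nat.cast_sub hN] <;> linarith
  rw [le_div_iff₀ hlen] at hi1
  rw [div_le_iff₀ hlen] at hi2
  by_cases hpar : i.val % 2 = 0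
  · refine ⟨i, x0 + (N * (x - x0) - i.val * len), ⟨by linarith, by linarith⟩, ?_⟩
    simp only [uMap, if_pos hpar]
    field_simp
    ring
  · refine ⟨i, x0 + ((i.val + 1) * len - N * (x - x0)), ⟨by linarith, by linarith⟩, ?_⟩
    simp only [uMap, if_neg hpar]
    field_simp
    ring

lemma LInv_Lmap (w : Fin N × Fin N) (t : ℝ × ℝ) :
    LInv x0 y0 len N w (Lmap x0 y0 len N w t) = t := by
  simp [LInv, Lmap, uInv_uMap]

lemma Lmap_mem_sqD (hlen : 0 < len) (w : Fin N × Fin N) {t : ℝ × ℝ} (ht : t ∈ sqD x0 y0 len) :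
    Lmap x0 y0 len N w t ∈ sqD x0 y0 len :=
  ⟨uMap_mem_Icc hlen _ ht.1, uMap_mem_Icc hlen _ ht.2⟩

lemma cell_subset_sqD (hlen : 0 < len) (l : List (Fin N × Fin N)) :
    cell x0 y0 len N l ⊆ sqD x0 y0 len := by
  induction l with
  | nil => exact subset_rfl
  | cons w l ih => rintro _ ⟨t, ht, rfl⟩; exact Lmap_mem_sqD hlen w (ih ht)

lemma cell_append_subset (hlen : 0 < len) (l l' : List (Fin N × Fin N)) :
    cell x0 y0 len N (l ++ l') ⊆ cell x0 y0 len N l := by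
  induction l with
  | nil => exact cell_subset_sqD hlen l'
  | cons w l ih => exact Set.image_mono ih

lemma abs_sub_le_of_mem_cell (l : List (Fin N × Fin N)) {t t' : ℝ × ℝ}
    (ht : t ∈ cell x0 y0 len N l) (ht' : t' ∈ cell x0 y0 len N l) :
    |t.1 - t'.1| ≤ len / (N : ℝ) ^ l.length ∧ |t.2 - t'.2| ≤ len / (N : ℝ) ^ l.length := by
  induction l generalizing t t' with
  | nil =>
    obtain ⟨⟨h1, h2⟩, h3, h4⟩ := ht
    obtain ⟨⟨h5, h6⟩, h7, h8⟩ := ht'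
    simp only [List.length_nil, pow_zero, div_one]
    exact ⟨abs_le.2 ⟨by linarith, by linarith⟩, abs_le.2 ⟨by linarith, by linarith⟩⟩
  | cons w l ih =>
    obtain ⟨s, hs, rfl⟩ := ht
    obtain ⟨s', hs', rfl⟩ := ht'
    obtain ⟨h1, h2⟩ := ih hs hs'
    simp only [Lmap, abs_uMap_sub, List.length_cons, pow_succ, ← div_div]
    constructor <;> gcongr

lemma exists_mem_cell_append (hlen : 0 < len) (hN : 0 < N) (l : List (Fin N × Fin N)) (k : ℕ)
    {t : ℝ × ℝ} (ht : t ∈ cell x0 y0 len N l) :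
    ∃ w : Fin k → Fin N × Fin N, t ∈ cell x0 y0 len N (l ++ List.ofFn w) := by
  induction l generalizing t with
  | nil =>
    induction k generalizing t with
    | zero => exact ⟨Fin.elim0, by simpa using ht⟩
    | succ k ih =>
      obtain ⟨i, x, hx, hxt⟩ := exists_uMap_eq hlen hN ht.1
      obtain ⟨j, y, hy, hyt⟩ := exists_uMap_eq hlen hN ht.2
      obtain ⟨w, hw⟩ := ih (t := (x, y)) ⟨hx, hy⟩
      refine ⟨Fin.cons (i, j) w, ?_⟩
      rw [List.ofFn_cons]
      exact ⟨(x, y), hw, Prod.ext hxt hyt⟩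
  | cons a l ih =>
    obtain ⟨s, hs, rfl⟩ := ht
    obtain ⟨w, hw⟩ := ih hs
    exact ⟨w, s, hw, rfl⟩

lemma eudist_le {t t' : ℝ × ℝ} {d : ℝ} (h1 : |t.1 - t'.1| ≤ d) (h2 : |t.2 - t'.2| ≤ d) :
    eudist t t' ≤ 2 * d := by
  have hd : 0 ≤ d := (abs_nonneg _).trans h1
  have h3 := sq_le_sq' (abs_le.1 h1).1 (abs_le.1 h1).2
  have h4 := sq_le_sq' (abs_le.1 h2).1 (abs_le.1 h2).2
  exact Real.sqrt_le_iff.2 ⟨by positivity, by nlinarith⟩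

end Cells

section Oscillation

variable {φ : ℝ × ℝ → ℝ} {E : Set (ℝ × ℝ)} {B : ℝ}

lemma sub_le_oscil (hB : ∀ t ∈ E, |φ t| ≤ B) {s t : ℝ × ℝ} (hs : s ∈ E) (ht : t ∈ E) :
    φ s - φ t ≤ oscil φ E := by
  refine le_csSup ⟨2 * B, ?_⟩ ⟨(s, t), ⟨hs, ht⟩, rfl⟩
  rintro _ ⟨⟨a, b⟩, ⟨ha, hb⟩, rfl⟩
  have h1 := abs_le.1 (hB a ha)
  have h2 := abs_le.1 (hB b hb)
  simp only
  linarith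

lemma abs_sub_le_oscil (hB : ∀ t ∈ E, |φ t| ≤ B) {s t : ℝ × ℝ} (hs : s ∈ E) (ht : t ∈ E) :
    |φ s - φ t| ≤ oscil φ E :=
  abs_sub_le_iff.2 ⟨sub_le_oscil hB hs ht, sub_le_oscil hB ht hs⟩

lemma oscil_nonneg (hB : ∀ t ∈ E, |φ t| ≤ B) : 0 ≤ oscil φ E := by
  rcases E.eq_empty_or_nonempty with rfl | ⟨t, ht⟩
  · simp [oscil]
  · simpa using sub_le_oscil hB ht ht

lemma oscil_le {C : ℝ} (hC : 0 ≤ C) (h : ∀ s ∈ E, ∀ t ∈ E, φ s - φ t ≤ C) : oscil φ E ≤ C := by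
  refine Real.sSup_le ?_ hC
  rintro _ ⟨⟨a, b⟩, ⟨ha, hb⟩, rfl⟩
  exact h a ha b hb

lemma supAbs_nonneg (S : ℝ × ℝ → ℝ) (E : Set (ℝ × ℝ)) : 0 ≤ supAbs S E := by
  refine Real.sSup_nonneg ?_
  rintro _ ⟨t, -, rfl⟩
  exact abs_nonneg _

lemma supAbs_le {S : ℝ × ℝ → ℝ} {C : ℝ} (hC : 0 ≤ C) (h : ∀ t ∈ E, |S t| ≤ C) :
    supAbs S E ≤ C := by
  refine Real.sSup_le ?_ hC
  rintro _ ⟨t, ht, rfl⟩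
  exact h t ht

lemma abs_le_supAbs {S : ℝ × ℝ → ℝ} {C : ℝ} (h : ∀ t ∈ E, |S t| ≤ C) {t : ℝ × ℝ} (ht : t ∈ E) :
    |S t| ≤ supAbs S E := by
  refine le_csSup ⟨C, ?_⟩ ⟨t, ht, rfl⟩
  rintro _ ⟨s, hs, rfl⟩
  exact h s hs

end Oscillation

section ScalingMatrix

variable {x0 y0 len : ℝ} {N : ℕ} {f S q : ℝ × ℝ → ℝ} {lamS lamq B : ℝ}

lemma oscil_cell_cons_le (hlen : 0 < len) (hlamS : 0 ≤ lamS) (hlamq : 0 ≤ lamq)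
    (hB : ∀ t ∈ sqD x0 y0 len, |f t| ≤ B)
    (hSlip : ∀ t₁ ∈ sqD x0 y0 len, ∀ t₂ ∈ sqD x0 y0 len, |S t₁ - S t₂| ≤ lamS * eudist t₁ t₂)
    (hS1 : ∀ t ∈ sqD x0 y0 len, |S t| < 1)
    (hqlip : ∀ t₁ ∈ sqD x0 y0 len, ∀ t₂ ∈ sqD x0 y0 len, |q t₁ - q t₂| ≤ lamq * eudist t₁ t₂)
    (hself : ∀ w : Fin N × Fin N, ∀ t ∈ cell x0 y0 len N [w],
      f t = S t * f (LInv x0 y0 len N w t) + q t)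
    (w : Fin N × Fin N) (l : List (Fin N × Fin N)) {E : Set (ℝ × ℝ)}
    (hE : E ⊆ sqD x0 y0 len) (hlE : cell x0 y0 len N (w :: l) ⊆ E) :
    oscil f (cell x0 y0 len N (w :: l)) ≤ supAbs S E * oscil f (cell x0 y0 len N l)
      + (lamS * B + lamq) * (2 * (len / (N : ℝ) ^ (l.length + 1))) := by
  have hBl : ∀ t ∈ cell x0 y0 len N l, |f t| ≤ B := fun t ht => hB t (cell_subset_sqD hlen l ht)
  have hB0 : 0 ≤ B := (abs_nonneg _).trans
    (hB (x0, y0) ⟨⟨le_rfl, by simp [hlen.le]⟩, le_rfl, by simp [hlen.le]⟩)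
  have hO := oscil_nonneg hBl
  have hA := supAbs_nonneg S E
  refine oscil_le (by positivity) ?_
  rintro t ht t' ht'
  obtain ⟨h1, h2⟩ := abs_sub_le_of_mem_cell _ ht ht'
  have hd := eudist_le h1 h2
  rw [List.length_cons] at hd
  have hSt := abs_le_supAbs (fun t ht => (hS1 t (hE ht)).le) (hlE ht)
  have hS := (hSlip t (hE (hlE ht)) t' (hE (hlE ht'))).trans (mul_le_mul_of_nonneg_left hd hlamS)
  have hq := (hqlip t (hE (hlE ht)) t' (hE (hlE ht'))).trans (mul_le_mul_of_nonneg_left hd hlamq)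
  have hft := hself w t (Set.image_mono (cell_subset_sqD hlen l) ht)
  have hft' := hself w t' (Set.image_mono (cell_subset_sqD hlen l) ht')
  obtain ⟨s, hs, rfl⟩ := ht
  obtain ⟨s', hs', rfl⟩ := ht'
  rw [LInv_Lmap] at hft hft'
  set t := Lmap x0 y0 len N w s
  set t' := Lmap x0 y0 len N w s'
  set d := 2 * (len / (N : ℝ) ^ (l.length + 1))
  have e1 : S t * (f s - f s') ≤ supAbs S E * oscil f (cell x0 y0 len N l) := by
    refine (le_abs_self _).trans ?_
    rw [abs_mul]
    exact mul_le_mul hSt (abs_sub_le_oscil hBl hs hs') (abs_nonneg _) hA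
  have e2 : (S t - S t') * f s' ≤ lamS * d * B := by
    refine (le_abs_self _).trans ?_
    rw [abs_mul]
    exact mul_le_mul hS (hBl s' hs') (abs_nonneg _) ((abs_nonneg _).trans hS)
  have e3 : q t - q t' ≤ lamq * d := (le_abs_self _).trans hq
  rw [hft, hft']
  linarith

lemma upMat_nonneg (S : ℝ × ℝ → ℝ) (m : ℕ) (i j : Fin (m + 1) → Fin N × Fin N) :
    0 ≤ upMat x0 y0 len N S m i j := by
  unfold upMat
  split_ifs
  · exact supAbs_nonneg _ _
  · exact le_rfl

lemma upMat_mulVec (S : ℝ × ℝ → ℝ) (m : ℕ) (v : (Fin (m + 1) → Fin N × Fin N) → ℝ)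
    (i : Fin (m + 1) → Fin N × Fin N) :
    (upMat x0 y0 len N S m).mulVec v i = ∑ a : Fin N × Fin N,
      supAbs S (cell x0 y0 len N (List.ofFn i ++ [a])) *
        v (Fin.snoc (α := fun _ => Fin N × Fin N) (Fin.tail i) a) := by
  classical
  simp only [Matrix.mulVec, dotProduct]
  rw [← (Fin.snocEquiv (fun _ : Fin (m + 1) => Fin N × Fin N)).sum_comp, Fintype.sum_prod_type]
  refine Finset.sum_congr rfl fun a _ => ?_
  rw [Finset.sum_eq_single (Fin.tail i)]
  · simp [upMat, Fin.snocEquiv, Fin.tail]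
  · intro b _ hb
    have hne : ¬ ∀ k : Fin m, i k.succ = b k := fun h => hb (funext fun k => (h k).symm)
    simp [upMat, Fin.snocEquiv, hne]
  · simp

lemma specRad_upMat_le (hlen : 0 < len) (hS1 : ∀ t ∈ sqD x0 y0 len, |S t| < 1) (m : ℕ) :
    specRad (upMat x0 y0 len N S m) ≤ ENNReal.ofReal (Fintype.card (Fin N × Fin N)) := by
  refine specRad_le_of_row_sum_le _ (upMat_nonneg S m) (Nat.cast_nonneg _) fun i => ?_
  have h := upMat_mulVec (x0 := x0) (y0 := y0) (len := len) S m 1 i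
  simp only [Matrix.mulVec, dotProduct, Pi.one_apply, mul_one] at h
  rw [h]
  calc _ ≤ ∑ _a : Fin N × Fin N, (1 : ℝ) := Finset.sum_le_sum fun a _ =>
        supAbs_le zero_le_one fun t ht => (hS1 t (cell_subset_sqD hlen _ ht)).le
    _ = _ := by simp

lemma oscSum_succ_le (hlen : 0 < len) (hlamS : 0 ≤ lamS) (hlamq : 0 ≤ lamq)
    (hB : ∀ t ∈ sqD x0 y0 len, |f t| ≤ B)
    (hSlip : ∀ t₁ ∈ sqD x0 y0 len, ∀ t₂ ∈ sqD x0 y0 len, |S t₁ - S t₂| ≤ lamS * eudist t₁ t₂)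
    (hS1 : ∀ t ∈ sqD x0 y0 len, |S t| < 1)
    (hqlip : ∀ t₁ ∈ sqD x0 y0 len, ∀ t₂ ∈ sqD x0 y0 len, |q t₁ - q t₂| ≤ lamq * eudist t₁ t₂)
    (hself : ∀ w : Fin N × Fin N, ∀ t ∈ cell x0 y0 len N [w],
      f t = S t * f (LInv x0 y0 len N w t) + q t)
    (m k : ℕ) (i : Fin (m + 1) → Fin N × Fin N) :
    oscSum x0 y0 len N f (List.ofFn i) (k + 1) ≤
      (upMat x0 y0 len N S m).mulVec (fun j => oscSum x0 y0 len N f (List.ofFn j) k) i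
        + (lamS * B + lamq) * (2 * (len / (N : ℝ) ^ (m + 1))) * (N : ℝ) ^ (k + 1) := by
  have hN : (N : ℝ) ≠ 0 := by exact_mod_cast (i 0).1.pos.ne'
  have hlist : ∀ (a : Fin N × Fin N) (w : Fin k → Fin N × Fin N),
      List.ofFn i ++ List.ofFn (Fin.cons a w : Fin (k + 1) → Fin N × Fin N) =
        i 0 :: (List.ofFn (Fin.snoc (α := fun _ => Fin N × Fin N) (Fin.tail i) a)
          ++ List.ofFn w) := by
    intro a w
    rw [List.ofFn_cons, List.ofFn_succ, List.ofFn_succ' (Fin.snoc _ _)]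
    simp [Fin.tail]
  rw [upMat_mulVec]
  unfold oscSum
  rw [← (Fin.consEquiv (fun _ : Fin (k + 1) => Fin N × Fin N)).sum_comp, Fintype.sum_prod_type]
  have hterm : ∀ (a : Fin N × Fin N) (w : Fin k → Fin N × Fin N),
      oscil f (cell x0 y0 len N
          (List.ofFn i ++ List.ofFn (Fin.cons a w : Fin (k + 1) → Fin N × Fin N))) ≤
        supAbs S (cell x0 y0 len N (List.ofFn i ++ [a])) *
          oscil f (cell x0 y0 len N
            (List.ofFn (Fin.snoc (α := fun _ => Fin N × Fin N) (Fin.tail i) a) ++ List.ofFn w))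
        + (lamS * B + lamq) * (2 * (len / (N : ℝ) ^ (m + 1 + k + 1))) := by
    intro a w
    have hsub : cell x0 y0 len N
        (List.ofFn i ++ List.ofFn (Fin.cons a w : Fin (k + 1) → Fin N × Fin N)) ⊆
          cell x0 y0 len N (List.ofFn i ++ [a]) := by
      have := cell_append_subset (x0 := x0) (y0 := y0) hlen (List.ofFn i ++ [a]) (List.ofFn w)
      rwa [List.append_assoc, List.singleton_append, ← List.ofFn_cons] at this
    rw [hlist] at hsub ⊢
    have := oscil_cell_cons_le hlen hlamS hlamq hB hSlip hS1 hqlip hself (i 0) _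
      (cell_subset_sqD hlen _) hsub
    simpa only [List.length_append, List.length_ofFn] using this
  calc _ ≤ ∑ a : Fin N × Fin N, ∑ w : Fin k → Fin N × Fin N,
        (supAbs S (cell x0 y0 len N (List.ofFn i ++ [a])) *
          oscil f (cell x0 y0 len N
            (List.ofFn (Fin.snoc (α := fun _ => Fin N × Fin N) (Fin.tail i) a) ++ List.ofFn w))
        + (lamS * B + lamq) * (2 * (len / (N : ℝ) ^ (m + 1 + k + 1)))) :=
        Finset.sum_le_sum fun a _ => Finset.sum_le_sum fun w _ => hterm a w
    _ = _ := by
      simp only [Finset.sum_add_distrib, ← Finset.mul_sum, Finset.sum_const, Finset.card_univ,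
        Fintype.card_prod, Fintype.card_fin, Fintype.card_fun, nsmul_eq_mul, Nat.cast_mul,
        Nat.cast_pow]
      congr 1
      field_simp
      ring

end ScalingMatrix

lemma ubDim_graphOn_le_of_specRad_lt {x0 y0 len : ℝ} (hlen : 0 < len) {N : ℕ} (hN : 2 ≤ N)
    {f S q : ℝ × ℝ → ℝ} {lamS lamq : ℝ} (hlamS : 0 ≤ lamS) (hlamq : 0 ≤ lamq)
    (hf : ContinuousOn f (sqD x0 y0 len))
    (hSlip : ∀ t₁ ∈ sqD x0 y0 len, ∀ t₂ ∈ sqD x0 y0 len, |S t₁ - S t₂| ≤ lamS * eudist t₁ t₂)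
    (hS1 : ∀ t ∈ sqD x0 y0 len, |S t| < 1)
    (hqlip : ∀ t₁ ∈ sqD x0 y0 len, ∀ t₂ ∈ sqD x0 y0 len, |q t₁ - q t₂| ≤ lamq * eudist t₁ t₂)
    (hself : ∀ w : Fin N × Fin N, ∀ t ∈ cell x0 y0 len N [w],
      f t = S t * f (LInv x0 y0 len N w t) + q t)
    {m : ℕ} {r : ℝ} (hNr : (N : ℝ) < r)
    (hr : specRad (upMat x0 y0 len N S m) < ENNReal.ofReal r) :
    ubDim (graphOn f (sqD x0 y0 len)) ≤ 1 + Real.log r / Real.log (N : ℝ) := by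
  have hN2 : (2 : ℝ) ≤ N := by exact_mod_cast hN
  obtain ⟨B, hB⟩ : ∃ B, ∀ t ∈ sqD x0 y0 len, |f t| ≤ B :=
    (isCompact_Icc.prod isCompact_Icc).exists_bound_of_continuousOn hf
  have hBcell : ∀ l, ∀ t ∈ cell x0 y0 len N l, |f t| ≤ B :=
    fun l t ht => hB t (cell_subset_sqD hlen l ht)
  have hB0 : 0 ≤ B := (abs_nonneg _).trans
    (hB (x0, y0) ⟨⟨le_rfl, by simp [hlen.le]⟩, le_rfl, by simp [hlen.le]⟩)
  obtain ⟨K, hK0, hK⟩ := exists_growth_bound _ (upMat_nonneg S m) (Nat.cast_nonneg N) hNr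
    (by positivity) hr (fun k i => oscSum x0 y0 len N f (List.ofFn i) k)
    (fun k i => oscSum_succ_le hlen hlamS hlamq hB hSlip hS1 hqlip hself m k i)
  let ι := Fin (m + 1) → Fin N × Fin N
  set s := len / (N : ℝ) ^ (m + 1)
  have hs0 : 0 < s := by positivity
  refine ubDim_le_of_cubeCount_le _ (s := s) (b := N) (r := r) (K := 32 * (Fintype.card ι : ℝ) * (K / s + 1)) hs0
    (by linarith) (by linarith) (by positivity) fun k ε hε hle hge => ?_
  have hcount := cubeCount_graphOn_le (ι := ι × (Fin k → Fin N × Fin N)) f (sqD x0 y0 len)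
    (fun p => cell x0 y0 len N (List.ofFn p.1 ++ List.ofFn p.2))
    (fun p => oscil f (cell x0 y0 len N (List.ofFn p.1 ++ List.ofFn p.2))) hε
    (fun p => oscil_nonneg (hBcell _))
    (fun t ht => by
      obtain ⟨i, hi⟩ := exists_mem_cell_append hlen (Nat.zero_lt_of_lt hN) [] (m + 1) ht
      obtain ⟨w, hw⟩ := exists_mem_cell_append hlen (Nat.zero_lt_of_lt hN) _ k hi
      exact ⟨(i, w), hw⟩)
    (fun p t ht t' ht' => by
      obtain ⟨h1, h2⟩ := abs_sub_le_of_mem_cell _ ht ht'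
      rw [List.length_append, List.length_ofFn, List.length_ofFn, pow_add, ← div_div] at h1 h2
      exact ⟨h1.trans hle, h2.trans hle, abs_sub_le_oscil (hBcell _) ht ht'⟩)
  have hrk : 0 < r ^ k := pow_pos (by linarith) k
  have hNk : (N : ℝ) ^ k ≤ r ^ k := by gcongr
  calc _ ≤ _ := hcount
    _ = ∑ i : ι, (32 * (oscSum x0 y0 len N f (List.ofFn i) k * (1 / ε))
          + 32 * ((N : ℝ) ^ k * (N : ℝ) ^ k)) := by
      rw [Fintype.sum_prod_type]
      refine Finset.sum_congr rfl fun i _ => ?_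
      simp only [oscSum, mul_add, Finset.sum_add_distrib, ← Finset.mul_sum, ← Finset.sum_div,
        Finset.sum_const, Finset.card_univ, Fintype.card_prod, Fintype.card_fin,
        Fintype.card_fun, nsmul_eq_mul, Nat.cast_mul, Nat.cast_pow]
      ring
    _ ≤ ∑ i : ι, (32 * (K * r ^ k * ((N : ℝ) ^ k / s)) + 32 * (r ^ k * (N : ℝ) ^ k)) := by
      refine Finset.sum_le_sum fun i _ => ?_
      have := hK k i
      gcongr
    _ = _ := by
      rw [Finset.sum_const, Finset.card_univ, nsmul_eq_mul, mul_pow]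
      ring

/-- upper bound for the upper box dimension of the graph of the FIF:
dim_B̄ Γf ≤ max {2, 1 + log ρ^*/log N}, where ρ^* = lim_n ρ(M̄_n). -/
theorem upper_box_dim_le (x0 y0 len : ℝ) (hlen : 0 < len) (N : ℕ) (hN : 2 ≤ N)
    (f S q : ℝ × ℝ → ℝ) (lamS lamq : ℝ) (hlamS : 0 < lamS) (hlamq : 0 < lamq)
    (hf : ContinuousOn f (sqD x0 y0 len))
    (hSlip : ∀ t₁ ∈ sqD x0 y0 len, ∀ t₂ ∈ sqD x0 y0 len, |S t₁ - S t₂| ≤ lamS * eudist t₁ t₂)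
    (hS1 : ∀ t ∈ sqD x0 y0 len, |S t| < 1)
    (hqlip : ∀ t₁ ∈ sqD x0 y0 len, ∀ t₂ ∈ sqD x0 y0 len, |q t₁ - q t₂| ≤ lamq * eudist t₁ t₂)
    (hself : ∀ w : Fin N × Fin N, ∀ t ∈ cell x0 y0 len N [w],
      f t = S t * f (LInv x0 y0 len N w t) + q t)
    (hNZ : ∀ a b c d : ℝ, x0 ≤ a → a < b → b ≤ x0 + len → y0 ≤ c → c < d → d ≤ y0 + len →
      ∃ t ∈ Set.Icc a b ×ˢ Set.Icc c d, S t ≠ 0) :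
    ∀ rhoStar : ENNReal,
      Filter.Tendsto (fun m : ℕ => specRad (upMat x0 y0 len N S m)) Filter.atTop (nhds rhoStar) →
      ubDim (graphOn f (sqD x0 y0 len)) ≤
        max 2 (1 + Real.log rhoStar.toReal / Real.log (N : ℝ)) := by
  intro rhoStar hlim
  have hN2 : (2 : ℝ) ≤ N := by exact_mod_cast hN
  have hN0 : (0 : ℝ) < N := by linarith
  have hlogN : 0 < Real.log N := Real.log_pos (by linarith)
  have htop : rhoStar ≠ ⊤ := ((le_of_tendsto' hlim fun m =>
    specRad_upMat_le hlen hS1 m).trans_lt ENNReal.ofReal_lt_top).ne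
  set R := max (N : ℝ) rhoStar.toReal with hR
  have hRN : (N : ℝ) ≤ R := le_max_left _ _
  have hbound : ∀ r, R < r → ubDim (graphOn f (sqD x0 y0 len)) ≤ 1 + Real.log r / Real.log N := by
    intro r hr
    have hlt : rhoStar < ENNReal.ofReal r :=
      (ENNReal.lt_ofReal_iff_toReal_lt htop).2 ((le_max_right _ _).trans_lt hr)
    obtain ⟨m, hm⟩ := (hlim.eventually (gt_mem_nhds hlt)).exists
    exact ubDim_graphOn_le_of_specRad_lt hlen hN hlamS.le hlamq.le hf hSlip hS1 hqlip hself
      (hRN.trans_lt hr) hm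
  have hcont : Filter.Tendsto (fun r : ℝ => 1 + Real.log r / Real.log N)
      (nhdsWithin R (Set.Ioi R)) (nhds (1 + Real.log R / Real.log N)) :=
    (((Real.continuousAt_log (hN0.trans_le hRN).ne').div_const _).const_add 1).tendsto.mono_left
      nhdsWithin_le_nhds
  refine (ge_of_tendsto hcont (Filter.eventually_of_mem self_mem_nhdsWithin hbound)).trans ?_
  rcases max_choice (N : ℝ) rhoStar.toReal with h | h
  · refine le_max_of_le_left ?_
    rw [hR, h, div_self hlogN.ne']
    norm_num
  · exact le_max_of_le_right (by rw [hR, h])
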